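/- arXiv:1810.01337 — 2 statements merged into one kernel-verified Lean document; each statement's English description precedes it below -/
import Mathlib

section
/- Let ψ : ℝ × ℝ → ℝ be twice continuously differentiable on U := ℝ × (2M,∞) and satisfy the mode-l Zerilli equation on U, and let β : (2M,∞) → ℝ be continuously differentiable. Then at every point of U the multiplier identity ∂_t[ r²β ∂_rψ(−(1+μ)∂_tψ + μ∂_rψ) ] + ∂_r[ ½r²β((1+μ)(∂_tψ)² + (1−μ)(∂_rψ)²) − ½(l(l+1)+r²W_λ)β ψ² ] = ( ½β′r²(1+μ) + (r+M)β )(∂_tψ)² + ( ½β′r²(1−μ) − (r−M)β )(∂_rψ)² − 2Mβ ∂_tψ∂_rψ − ½((l(l+1)+r²W_λ)β)′ ψ² holds, where ′ denotes d/dr. -/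
noncomputable section

open Set

/-- The partial derivative `∂_t` of a function of `(t,r) ∈ ℝ × ℝ`. -/
def pt (f : ℝ × ℝ → ℝ) (p : ℝ × ℝ) : ℝ := fderiv ℝ f p ((1 : ℝ), (0 : ℝ))

/-- The partial derivative `∂_r` of a function of `(t,r) ∈ ℝ × ℝ`. -/
def pr (f : ℝ × ℝ → ℝ) (p : ℝ × ℝ) : ℝ := fderiv ℝ f p ((0 : ℝ), (1 : ℝ))

/-- `μ = 2M/r` on the Schwarzschild exterior. -/
def mu (M r : ℝ) : ℝ := 2 * M / r

/-- The Zerilli potential `W_λ(r)` on the spherical-harmonic mode with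
`λ = (l−1)(l+2)`. -/
def Wz (M lam r : ℝ) : ℝ :=
  -8 * M / r ^ 3 - 24 * M * (r - 3 * M) / (r ^ 4 * (lam + 3 * mu M r))
    + 72 * M ^ 2 * (r - 2 * M) / (r ^ 5 * (lam + 3 * mu M r) ^ 2)

/-- The mode-`l` Zerilli equation in Schwarzschild-star coordinates on
`U = ℝ × (2M,∞)`. -/
def ZerilliEq (M lam : ℝ) (l : ℤ) (ψ : ℝ × ℝ → ℝ) : Prop :=
  ∀ p : ℝ × ℝ, 2 * M < p.2 →
    pt (fun q : ℝ × ℝ =>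
        q.2 ^ 2 * (-(1 + mu M q.2) * pt ψ q + mu M q.2 * pr ψ q)) p
    + pr (fun q : ℝ × ℝ =>
        q.2 ^ 2 * (mu M q.2 * pt ψ q + (1 - mu M q.2) * pr ψ q)) p
    - (l : ℝ) * ((l : ℝ) + 1) * ψ p - p.2 ^ 2 * Wz M lam p.2 * ψ p = 0

lemma HasFDerivAt.pt_eq {f : ℝ × ℝ → ℝ} {f' : ℝ × ℝ →L[ℝ] ℝ} {p : ℝ × ℝ}
    (hf : HasFDerivAt f f' p) : pt f p = f' (1, 0) := by
  rw [pt, hf.fderiv]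

lemma HasFDerivAt.pr_eq {f : ℝ × ℝ → ℝ} {f' : ℝ × ℝ →L[ℝ] ℝ} {p : ℝ × ℝ}
    (hf : HasFDerivAt f f' p) : pr f p = f' (0, 1) := by
  rw [pr, hf.fderiv]

/-- A function of `r` alone has derivative `g'(r) dr` on the `(t,r)`-plane. -/
lemma hasFDerivAt_comp_radius {g : ℝ → ℝ} {g' : ℝ} {p : ℝ × ℝ} (hg : HasDerivAt g g' p.2) :
    HasFDerivAt (fun q : ℝ × ℝ => g q.2) (g' • ContinuousLinearMap.snd ℝ ℝ ℝ) p :=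
  hg.comp_hasFDerivAt p hasFDerivAt_snd

lemma hasDerivAt_mu (M : ℝ) {r : ℝ} (hr : r ≠ 0) :
    HasDerivAt (mu M) (-(2 * M) / r ^ 2) r := by
  refine ((hasDerivAt_inv hr).const_mul (2 * M)).congr_deriv ?_
  ring

lemma differentiableAt_Wz {M lam r : ℝ} (hr : r ≠ 0) (hden : lam + 3 * mu M r ≠ 0) :
    DifferentiableAt ℝ (Wz M lam) r := by
  have hmu := (hasDerivAt_mu M hr).differentiableAt
  unfold Wz
  fun_prop (disch := positivity)

/-- The first partial derivatives of a `C²` function are differentiable, and the mixed second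
partial derivatives agree. -/
lemma exists_hasFDerivAt_pt_pr {ψ : ℝ × ℝ → ℝ} {p : ℝ × ℝ} (hψ : ContDiffAt ℝ 2 ψ p) :
    ∃ A B : ℝ × ℝ →L[ℝ] ℝ,
      HasFDerivAt (pt ψ) A p ∧ HasFDerivAt (pr ψ) B p ∧ A (0, 1) = B (1, 0) := by
  have hD : HasFDerivAt (fderiv ℝ ψ) (fderiv ℝ (fderiv ℝ ψ) p) p :=
    ((hψ.fderiv_right (m := 1) (by norm_num)).differentiableAt (by norm_num)).hasFDerivAt
  have hsymm : IsSymmSndFDerivAt ℝ ψ p := hψ.isSymmSndFDerivAt (by simp)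
  refine ⟨_, _, hD.clm_apply (hasFDerivAt_const _ _), hD.clm_apply (hasFDerivAt_const _ _), ?_⟩
  simpa using hsymm (0, 1) (1, 0)

/-- For `ψ` twice continuously differentiable on `U = ℝ × (2M,∞)`
solving the mode-`l` Zerilli equation and `β` continuously differentiable on
`(2M,∞)`, the multiplier identity

`∂_t[ r²β ∂_rψ(−(1+μ)∂_tψ + μ∂_rψ) ]
 + ∂_r[ ½r²β((1+μ)(∂_tψ)² + (1−μ)(∂_rψ)²) − ½(l(l+1)+r²W_λ)β ψ² ]
 = ( ½β′r²(1+μ) + (r+M)β )(∂_tψ)² + ( ½β′r²(1−μ) − (r−M)β )(∂_rψ)²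
   − 2Mβ ∂_tψ∂_rψ − ½((l(l+1)+r²W_λ)β)′ ψ²`

holds at every point of `U`. -/
theorem zerilli_multiplier_identity
    (M : ℝ) (hM : 0 < M) (l : ℤ) (hl : 2 ≤ l)
    (lam : ℝ) (hlam : lam = ((l : ℝ) - 1) * ((l : ℝ) + 2))
    (ψ : ℝ × ℝ → ℝ)
    (hψ : ContDiffOn ℝ 2 ψ {p : ℝ × ℝ | 2 * M < p.2})
    (hZ : ZerilliEq M lam l ψ)
    (β : ℝ → ℝ) (hβ : ContDiffOn ℝ 1 β (Ioi (2 * M))) :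
    ∀ p : ℝ × ℝ, 2 * M < p.2 →
      pt (fun q : ℝ × ℝ =>
          q.2 ^ 2 * β q.2 * pr ψ q *
            (-(1 + mu M q.2) * pt ψ q + mu M q.2 * pr ψ q)) p
      + pr (fun q : ℝ × ℝ =>
          (1 / 2) * q.2 ^ 2 * β q.2 *
              ((1 + mu M q.2) * (pt ψ q) ^ 2 + (1 - mu M q.2) * (pr ψ q) ^ 2)
            - (1 / 2) * ((l : ℝ) * ((l : ℝ) + 1) + q.2 ^ 2 * Wz M lam q.2) * β q.2 *
              ψ q ^ 2) p
      = ((1 / 2) * deriv β p.2 * p.2 ^ 2 * (1 + mu M p.2) + (p.2 + M) * β p.2) *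
            (pt ψ p) ^ 2
        + ((1 / 2) * deriv β p.2 * p.2 ^ 2 * (1 - mu M p.2) - (p.2 - M) * β p.2) *
            (pr ψ p) ^ 2
        - 2 * M * β p.2 * pt ψ p * pr ψ p
        - (1 / 2) *
            deriv (fun r : ℝ =>
              ((l : ℝ) * ((l : ℝ) + 1) + r ^ 2 * Wz M lam r) * β r) p.2 *
            ψ p ^ 2 := by
  intro p hp
  have hr : 0 < p.2 := by linarith
  have hmem : {q : ℝ × ℝ | 2 * M < q.2} ∈ nhds p :=
    (isOpen_lt continuous_const continuous_snd).mem_nhds hp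
  have hψp : ContDiffAt ℝ 2 ψ p := hψ.contDiffAt hmem
  obtain ⟨A, B, hA, hB, hAB⟩ := exists_hasFDerivAt_pt_pr hψp
  have hψ' : HasFDerivAt ψ (fderiv ℝ ψ p) p :=
    (hψp.differentiableAt (by norm_num)).hasFDerivAt
  have hβd : DifferentiableAt ℝ β p.2 :=
    (hβ.contDiffAt (Ioi_mem_nhds hp)).differentiableAt (by norm_num)
  have hlam_pos : 0 < lam := by
    have : (2 : ℝ) ≤ l := by exact_mod_cast hl
    rw [hlam]
    exact mul_pos (by linarith) (by linarith)
  have hden : lam + 3 * mu M p.2 ≠ 0 := by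
    unfold mu
    positivity
  have hW : DifferentiableAt ℝ (Wz M lam) p.2 := differentiableAt_Wz hr.ne' hden
  have hVd : DifferentiableAt ℝ
      (fun r : ℝ => ((l : ℝ) * ((l : ℝ) + 1) + r ^ 2 * Wz M lam r) * β r) p.2 := by
    fun_prop
  have hV : HasFDerivAt (fun q : ℝ × ℝ =>
      (1 / 2) * ((l : ℝ) * ((l : ℝ) + 1) + q.2 ^ 2 * Wz M lam q.2) * β q.2) _ p :=
    ((hasFDerivAt_comp_radius hVd.hasDerivAt).const_mul (1 / 2)).congr_of_eventuallyEq
      (.of_forall fun q => by ring)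
  have hb := hasFDerivAt_comp_radius hβd.hasDerivAt
  have hm := hasFDerivAt_comp_radius (hasDerivAt_mu M hr.ne')
  have hq := hasFDerivAt_comp_radius (hasDerivAt_pow 2 p.2)
  have hflux_t := ((hm.const_add 1).neg.mul hA).add (hm.mul hB)
  have hZt := hq.mul hflux_t
  have hZr := hq.mul ((hm.mul hA).add ((hm.const_sub 1).mul hB))
  have hLt := ((hq.mul hb).mul hB).mul hflux_t
  have hLr := (((hq.const_mul (1 / 2)).mul hb).mul
    (((hm.const_add 1).mul (hA.pow 2)).add ((hm.const_sub 1).mul (hB.pow 2)))).sub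
    (hV.mul (hψ'.pow 2))
  have hZp := (congrArg₂ (fun x y : ℝ => x + y - (l : ℝ) * ((l : ℝ) + 1) * ψ p
    - p.2 ^ 2 * Wz M lam p.2 * ψ p) hZt.pt_eq hZr.pr_eq).symm.trans (hZ p hp)
  refine (congrArg₂ (· + ·) hLt.pt_eq hLr.pr_eq).trans ?_
  have hψr : fderiv ℝ ψ p (0, 1) = pr ψ p := rfl
  simp [hAB, hψr] at hZp ⊢
  have hmu : mu M p.2 * p.2 = 2 * M := div_mul_cancel₀ _ hr.ne'
  have hmu' : p.2 ^ 2 * (-(2 * M) / p.2 ^ 2) = -(2 * M) := mul_div_cancel₀ _ (by positivity)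
  linear_combination (β p.2 * pr ψ p) * hZp
    + (β p.2 * (pt ψ p ^ 2 - pr ψ p ^ 2) - 2 * β p.2 * pr ψ p * (pt ψ p - pr ψ p)) * hmu
    + (β p.2 * (pt ψ p ^ 2 - pr ψ p ^ 2) / 2 - β p.2 * pr ψ p * (pt ψ p - pr ψ p)) * hmu'
end
end

section
/- Let ψ : ℝ × ℝ → ℝ be twice continuously differentiable on U := ℝ × (2M,∞) and satisfy the mode-l Zerilli equation on U. Then for all real numbers t₁ ≤ t₂ and 2M < r₁ ≤ r₂, the conservation law ∫_{r₁}^{r₂} E(t₂,r) dr − ∫_{r₁}^{r₂} E(t₁,r) dr = ∫_{t₁}^{t₂} F(t,r₂) dt − ∫_{t₁}^{t₂} F(t,r₁) dt holds, where E and F are the energy density and flux associated to ψ. -/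
noncomputable section

open Set

/-- The Zerilli energy density
`E = ½r²(1+μ)(∂_tψ)² + ½r²(1−μ)(∂_rψ)² + ½(l(l+1)+r²W_λ)ψ²`. -/
def Ez (M lam : ℝ) (l : ℤ) (ψ : ℝ × ℝ → ℝ) (p : ℝ × ℝ) : ℝ :=
  (1 / 2) * p.2 ^ 2 * (1 + mu M p.2) * (pt ψ p) ^ 2
  + (1 / 2) * p.2 ^ 2 * (1 - mu M p.2) * (pr ψ p) ^ 2
  + (1 / 2) * ((l : ℝ) * ((l : ℝ) + 1) + p.2 ^ 2 * Wz M lam p.2) * ψ p ^ 2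

/-- The Zerilli energy flux `F = r²∂_tψ(μ∂_tψ + (1−μ)∂_rψ)`. -/
def Fz (M : ℝ) (ψ : ℝ × ℝ → ℝ) (p : ℝ × ℝ) : ℝ :=
  p.2 ^ 2 * pt ψ p * (mu M p.2 * pt ψ p + (1 - mu M p.2) * pr ψ p)

open MeasureTheory
open scoped Interval

/-- The conservation law follows from the local identity `∂_t E = ∂_r F` for `C¹` fields. -/
theorem integral_sub_eq_of_pt_eq_pr {E F : ℝ × ℝ → ℝ} {U : Set (ℝ × ℝ)} (hU : IsOpen U)
    (hE : ContDiffOn ℝ 1 E U) (hF : ContDiffOn ℝ 1 F U) (hEF : ∀ p ∈ U, pt E p = pr F p)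
    {t₁ t₂ r₁ r₂ : ℝ} (hsub : [[t₁, t₂]] ×ˢ [[r₁, r₂]] ⊆ U) :
    (∫ r in r₁..r₂, E (t₂, r)) - (∫ r in r₁..r₂, E (t₁, r))
      = (∫ t in t₁..t₂, F (t, r₂)) - (∫ t in t₁..t₂, F (t, r₁)) := by
  have hdiff {f : ℝ × ℝ → ℝ} (hf : ContDiffOn ℝ 1 f U) {p : ℝ × ℝ} (hp : p ∈ U) :
      HasFDerivAt f (fderiv ℝ f p) p :=
    ((hf.contDiffAt (hU.mem_nhds hp)).differentiableAt one_ne_zero).hasFDerivAt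
  have hdiv : ∀ p ∈ [[t₁, t₂]] ×ˢ [[r₁, r₂]],
      fderiv ℝ E p (1, 0) + (-fderiv ℝ F p) (0, 1) = 0 := fun p hp => by
    have h := hEF p (hsub hp)
    simp only [pt, pr] at h
    simp [h]
  have hmem : Ioo (min t₁ t₂) (max t₁ t₂) ×ˢ Ioo (min r₁ r₂) (max r₁ r₂)
      ⊆ [[t₁, t₂]] ×ˢ [[r₁, r₂]] := prod_mono Ioo_subset_Icc_self Ioo_subset_Icc_self
  have key := integral2_divergence_prod_of_hasFDerivAt E (fun p => -F p) (fderiv ℝ E)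
    (fun p => -fderiv ℝ F p) t₁ r₁ t₂ r₂ (hE.continuousOn.mono hsub)
    (hF.continuousOn.neg.mono hsub) (fun p hp => hdiff hE (hsub (hmem hp)))
    (fun p hp => (hdiff hF (hsub (hmem hp))).neg)
    ((integrableOn_congr_fun hdiv (measurableSet_uIcc.prod measurableSet_uIcc)).2 integrableOn_zero)
  have hzero : (∫ x in t₁..t₂, ∫ y in r₁..r₂,
      (fderiv ℝ E (x, y) (1, 0) + (-fderiv ℝ F (x, y)) (0, 1))) = 0 := by
    rw [intervalIntegral.integral_congr (g := fun _ => (0 : ℝ)), intervalIntegral.integral_zero]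
    intro x hx
    dsimp only
    rw [intervalIntegral.integral_congr (g := fun _ => (0 : ℝ)), intervalIntegral.integral_zero]
    exact fun y hy => hdiv (x, y) ⟨hx, hy⟩
  rw [hzero] at key
  simp only [intervalIntegral.integral_neg] at key
  linarith

theorem isOpen_exterior (M : ℝ) : IsOpen {p : ℝ × ℝ | 2 * M < p.2} :=
  isOpen_lt continuous_const continuous_snd

theorem contDiffOn_mu {M : ℝ} (hM : 0 < M) {n : WithTop ℕ∞} :
    ContDiffOn ℝ n (fun p : ℝ × ℝ => mu M p.2) {p : ℝ × ℝ | 2 * M < p.2} := by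
  refine contDiffOn_const.div contDiffOn_snd fun p hp => ?_
  have : 2 * M < p.2 := hp
  linarith

theorem contDiffOn_Wz {M lam : ℝ} (hM : 0 < M) (hlam : 0 < lam) {n : WithTop ℕ∞} :
    ContDiffOn ℝ n (fun p : ℝ × ℝ => Wz M lam p.2) {p : ℝ × ℝ | 2 * M < p.2} := by
  have hr : ∀ p ∈ {p : ℝ × ℝ | 2 * M < p.2}, 0 < p.2 := fun p hp => by
    have : 2 * M < p.2 := hp
    linarith
  have hden : ∀ p ∈ {p : ℝ × ℝ | 2 * M < p.2}, 0 < lam + 3 * mu M p.2 := fun p hp => by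
    have := hr p hp
    unfold mu
    positivity
  have hmu := contDiffOn_mu hM (n := n)
  unfold Wz
  refine ((contDiffOn_const.div (by fun_prop) fun p hp => ?_).sub
    (ContDiffOn.div (by fun_prop) (by fun_prop) fun p hp => ?_)).add
    (ContDiffOn.div (by fun_prop) (by fun_prop) fun p hp => ?_) <;>
  · have := hr p hp
    have := hden p hp
    positivity

theorem contDiffOn_pt {ψ : ℝ × ℝ → ℝ} {U : Set (ℝ × ℝ)} (hU : IsOpen U)
    (hψ : ContDiffOn ℝ 2 ψ U) : ContDiffOn ℝ 1 (pt ψ) U :=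
  (hψ.fderiv_of_isOpen (m := 1) hU (by norm_num)).clm_apply contDiffOn_const

theorem contDiffOn_pr {ψ : ℝ × ℝ → ℝ} {U : Set (ℝ × ℝ)} (hU : IsOpen U)
    (hψ : ContDiffOn ℝ 2 ψ U) : ContDiffOn ℝ 1 (pr ψ) U :=
  (hψ.fderiv_of_isOpen (m := 1) hU (by norm_num)).clm_apply contDiffOn_const

/-- Mixed partial derivatives of a `C²` function commute. -/
theorem pt_pr_comm {ψ : ℝ × ℝ → ℝ} {p : ℝ × ℝ} (hψ : ContDiffAt ℝ 2 ψ p) :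
    pt (pr ψ) p = pr (pt ψ) p := by
  have hd : DifferentiableAt ℝ (fderiv ℝ ψ) p :=
    (hψ.fderiv_right (m := 1) (by norm_num)).differentiableAt one_ne_zero
  have hsymm := hψ.isSymmSndFDerivAt (by simp)
  have happly (v w : ℝ × ℝ) :
      fderiv ℝ (fun q => fderiv ℝ ψ q v) p w = fderiv ℝ (fderiv ℝ ψ) p w v := by
    rw [fderiv_clm_apply hd (differentiableAt_const v)]
    simp
  change fderiv ℝ (fun q => fderiv ℝ ψ q (0, 1)) p (1, 0)
    = fderiv ℝ (fun q => fderiv ℝ ψ q (1, 0)) p (0, 1)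
  rw [happly, happly]
  exact hsymm _ _

theorem pt_mul {f g : ℝ × ℝ → ℝ} {p : ℝ × ℝ} (hf : DifferentiableAt ℝ f p)
    (hg : DifferentiableAt ℝ g p) :
    pt (fun q => f q * g q) p = f p * pt g p + pt f p * g p := by
  simp [pt, fderiv_fun_mul hf hg, mul_comm]

theorem pr_mul {f g : ℝ × ℝ → ℝ} {p : ℝ × ℝ} (hf : DifferentiableAt ℝ f p)
    (hg : DifferentiableAt ℝ g p) :
    pr (fun q => f q * g q) p = f p * pr g p + pr f p * g p := by
  simp [pr, fderiv_fun_mul hf hg, mul_comm]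

theorem pt_add {f g : ℝ × ℝ → ℝ} {p : ℝ × ℝ} (hf : DifferentiableAt ℝ f p)
    (hg : DifferentiableAt ℝ g p) :
    pt (fun q => f q + g q) p = pt f p + pt g p := by
  simp [pt, fderiv_fun_add hf hg]

theorem pt_comp_snd {c : ℝ → ℝ} {p : ℝ × ℝ} (hc : DifferentiableAt ℝ (fun q : ℝ × ℝ => c q.2) p) :
    pt (fun q => c q.2) p = 0 := by
  have hline : HasDerivAt (fun t : ℝ => ((t, p.2) : ℝ × ℝ)) (1, 0) p.1 :=
    (hasDerivAt_id p.1).prodMk (hasDerivAt_const p.1 p.2)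
  exact (HasFDerivAt.comp_hasDerivAt (l := fun q : ℝ × ℝ => c q.2) p.1 hc.hasFDerivAt hline).unique
    (hasDerivAt_const p.1 (c p.2))

theorem pt_comp_snd_mul {c : ℝ → ℝ} {f : ℝ × ℝ → ℝ} {p : ℝ × ℝ}
    (hc : DifferentiableAt ℝ (fun q : ℝ × ℝ => c q.2) p) (hf : DifferentiableAt ℝ f p) :
    pt (fun q => c q.2 * f q) p = c p.2 * pt f p := by
  rw [pt_mul hc hf, pt_comp_snd hc, zero_mul, add_zero]

theorem pt_sq {f : ℝ × ℝ → ℝ} {p : ℝ × ℝ} (hf : DifferentiableAt ℝ f p) :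
    pt (fun q => f q ^ 2) p = 2 * f p * pt f p := by
  simp only [sq, pt_mul hf hf]
  ring

theorem contDiffOn_Ez {M lam : ℝ} (hM : 0 < M) (hlam : 0 < lam) (l : ℤ) {ψ : ℝ × ℝ → ℝ}
    (hψ : ContDiffOn ℝ 2 ψ {p : ℝ × ℝ | 2 * M < p.2}) :
    ContDiffOn ℝ 1 (Ez M lam l ψ) {p : ℝ × ℝ | 2 * M < p.2} := by
  have hmu := contDiffOn_mu hM (n := 1)
  have hW := contDiffOn_Wz hM hlam (n := 1)
  have ht := contDiffOn_pt (isOpen_exterior M) hψ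
  have hr := contDiffOn_pr (isOpen_exterior M) hψ
  have hψ' := hψ.of_le one_le_two
  unfold Ez
  fun_prop

theorem contDiffOn_Fz {M : ℝ} (hM : 0 < M) {ψ : ℝ × ℝ → ℝ}
    (hψ : ContDiffOn ℝ 2 ψ {p : ℝ × ℝ | 2 * M < p.2}) :
    ContDiffOn ℝ 1 (Fz M ψ) {p : ℝ × ℝ | 2 * M < p.2} := by
  have hmu := contDiffOn_mu hM (n := 1)
  have ht := contDiffOn_pt (isOpen_exterior M) hψ
  have hr := contDiffOn_pr (isOpen_exterior M) hψ
  unfold Fz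
  fun_prop

/-- The local form `∂_t E = ∂_r F` of the conservation law. -/
theorem pt_Ez_eq_pr_Fz {M lam : ℝ} (hM : 0 < M) (hlam : 0 < lam) {l : ℤ} {ψ : ℝ × ℝ → ℝ}
    (hψ : ContDiffOn ℝ 2 ψ {p : ℝ × ℝ | 2 * M < p.2}) (hZ : ZerilliEq M lam l ψ)
    {p : ℝ × ℝ} (hp : 2 * M < p.2) : pt (Ez M lam l ψ) p = pr (Fz M ψ) p := by
  have hnhds := (isOpen_exterior M).mem_nhds hp
  have hdiff {f : ℝ × ℝ → ℝ} (hf : ContDiffOn ℝ 1 f {p : ℝ × ℝ | 2 * M < p.2}) :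
      DifferentiableAt ℝ f p := (hf.contDiffAt hnhds).differentiableAt one_ne_zero
  have hmu := hdiff (contDiffOn_mu hM)
  have hW := hdiff (contDiffOn_Wz hM hlam)
  have ht := hdiff (contDiffOn_pt (isOpen_exterior M) hψ)
  have hr := hdiff (contDiffOn_pr (isOpen_exterior M) hψ)
  have hψ' := hdiff (hψ.of_le one_le_two)
  have hcomm := pt_pr_comm (hψ.contDiffAt hnhds)
  have hE : pt (Ez M lam l ψ) p = p.2 ^ 2 * (1 + mu M p.2) * pt ψ p * pt (pt ψ) p
      + p.2 ^ 2 * (1 - mu M p.2) * pr ψ p * pr (pt ψ) p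
      + ((l : ℝ) * ((l : ℝ) + 1) + p.2 ^ 2 * Wz M lam p.2) * ψ p * pt ψ p := by
    unfold Ez
    rw [pt_add (by fun_prop) (by fun_prop), pt_add (by fun_prop) (by fun_prop),
      pt_comp_snd_mul (c := fun r => 1 / 2 * r ^ 2 * (1 + mu M r)) (by fun_prop) (by fun_prop),
      pt_comp_snd_mul (c := fun r => 1 / 2 * r ^ 2 * (1 - mu M r)) (by fun_prop) (by fun_prop),
      pt_comp_snd_mul (c := fun r => 1 / 2 * ((l : ℝ) * ((l : ℝ) + 1) + r ^ 2 * Wz M lam r))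
        (by fun_prop) (by fun_prop),
      pt_sq ht, pt_sq hr, pt_sq hψ', hcomm]
    ring
  have hflux : Fz M ψ = fun q => pt ψ q
      * (q.2 ^ 2 * (mu M q.2 * pt ψ q + (1 - mu M q.2) * pr ψ q)) := by
    funext q
    simp only [Fz]
    ring
  have hmomentum : pt (fun q : ℝ × ℝ =>
      q.2 ^ 2 * (-(1 + mu M q.2) * pt ψ q + mu M q.2 * pr ψ q)) p
      = p.2 ^ 2 * (-(1 + mu M p.2) * pt (pt ψ) p + mu M p.2 * pr (pt ψ) p) := by
    rw [pt_comp_snd_mul (c := fun r => r ^ 2) (by fun_prop) (by fun_prop),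
      pt_add (by fun_prop) (by fun_prop),
      pt_comp_snd_mul (c := fun r => -(1 + mu M r)) (by fun_prop) (by fun_prop),
      pt_comp_snd_mul (c := mu M) (by fun_prop) (by fun_prop), hcomm]
  have hZp := hZ p hp
  rw [hmomentum] at hZp
  rw [hE, hflux, pr_mul ht (by fun_prop)]
  linear_combination -pt ψ p * hZp

/-- For `ψ` twice continuously differentiable on `U = ℝ × (2M,∞)`
solving the mode-`l` Zerilli equation, and all `t₁ ≤ t₂` and `2M < r₁ ≤ r₂`, the
conservation law
`∫_{r₁}^{r₂} E(t₂,r) dr − ∫_{r₁}^{r₂} E(t₁,r) dr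
  = ∫_{t₁}^{t₂} F(t,r₂) dt − ∫_{t₁}^{t₂} F(t,r₁) dt` holds. -/
theorem zerilli_conservation_law
    (M : ℝ) (hM : 0 < M) (l : ℤ) (hl : 2 ≤ l)
    (lam : ℝ) (hlam : lam = ((l : ℝ) - 1) * ((l : ℝ) + 2))
    (ψ : ℝ × ℝ → ℝ)
    (hψ : ContDiffOn ℝ 2 ψ {p : ℝ × ℝ | 2 * M < p.2})
    (hZ : ZerilliEq M lam l ψ) :
    ∀ t₁ t₂ r₁ r₂ : ℝ, t₁ ≤ t₂ → 2 * M < r₁ → r₁ ≤ r₂ →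
      (∫ r in r₁..r₂, Ez M lam l ψ (t₂, r)) - (∫ r in r₁..r₂, Ez M lam l ψ (t₁, r))
        = (∫ t in t₁..t₂, Fz M ψ (t, r₂)) - (∫ t in t₁..t₂, Fz M ψ (t, r₁)) := by
  intro t₁ t₂ r₁ r₂ _ hr₁ hr
  have hl' : (2 : ℝ) ≤ l := by exact_mod_cast hl
  have hlam' : 0 < lam := by
    rw [hlam]
    exact mul_pos (by linarith) (by linarith)
  refine integral_sub_eq_of_pt_eq_pr (isOpen_exterior M) (contDiffOn_Ez hM hlam' l hψ)
    (contDiffOn_Fz hM hψ) (fun p hp => pt_Ez_eq_pr_Fz hM hlam' hψ hZ hp) ?_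
  rintro p ⟨-, hp⟩
  rw [uIcc_of_le hr] at hp
  exact hr₁.trans_le hp.1
end
end
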